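/- For the n-qubit GHZ state |GHZₙ⟩ (n ≥ 3), LU(GHZₙ) = LC(GHZₙ): every stabilizer state that is local-unitary equivalent to |GHZₙ⟩ is also local-Clifford equivalent to |GHZₙ⟩. -/

import Mathlib

open Matrix

noncomputable section

/-- Pauli matrices: `0 ↦ σ₀` (identity), `1 ↦ σₓ`, `2 ↦ σ_y`, `3 ↦ σ_z`. -/
def pauliMat : Fin 4 → Matrix (Fin 2) (Fin 2) ℂ :=
  ![1, !![0, 1; 1, 0], !![0, -Complex.I; Complex.I, 0], !![1, 0; 0, -1]]

/-- Tensor (Kronecker) product of a family of one-qubit operators, as an operator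
on qubits indexed by `ι`. -/
def kron {ι : Type} [Fintype ι] (U : ι → Matrix (Fin 2) (Fin 2) ℂ) :
    Matrix (ι → Fin 2) (ι → Fin 2) ℂ :=
  Matrix.of fun x y => ∏ i, U i (x i) (y i)

/-- An element of the Pauli group: a phase in `{1, -1, i, -i}` together with a
Pauli label (`σ₀, σₓ, σ_y, σ_z`) on every qubit. -/
structure PauliOp (ι : Type) where
  phase : ℂ
  label : ι → Fin 4
  phase_ok : phase = 1 ∨ phase = -1 ∨ phase = Complex.I ∨ phase = -Complex.I

noncomputable instance {ι : Type} : DecidableEq (PauliOp ι) := Classical.decEq _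

/-- The matrix of a Pauli group element. -/
def PauliOp.toMatrix {ι : Type} [Fintype ι] (M : PauliOp ι) :
    Matrix (ι → Fin 2) (ι → Fin 2) ℂ :=
  M.phase • kron fun i => pauliMat (M.label i)

/-- The support of a Pauli operator: the set of qubits on which it acts nontrivially. -/
def PauliOp.support {ι : Type} [Fintype ι] [DecidableEq ι] (M : PauliOp ι) : Finset ι :=
  Finset.univ.filter fun i => M.label i ≠ 0

/-- A (maximal) stabilizer on the qubits indexed by `ι`: an abelian subgroup of the
Pauli group of cardinality `2^|ι|` which does not contain `-I`. -/
structure Stabilizer (ι : Type) [Fintype ι] [DecidableEq ι] where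
  elems : Finset (PauliOp ι)
  one_mem : ∃ M ∈ elems, PauliOp.toMatrix M = 1
  mul_mem : ∀ M ∈ elems, ∀ N ∈ elems, ∃ K ∈ elems,
    PauliOp.toMatrix K = PauliOp.toMatrix M * PauliOp.toMatrix N
  comm : ∀ M ∈ elems, ∀ N ∈ elems,
    PauliOp.toMatrix M * PauliOp.toMatrix N = PauliOp.toMatrix N * PauliOp.toMatrix M
  neg_one_not_mem : ∀ M ∈ elems, PauliOp.toMatrix M ≠ -1
  card_elems : elems.card = 2 ^ Fintype.card ι

variable {ι : Type} [Fintype ι] [DecidableEq ι]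

/-- `ψ` is the stabilizer state of the stabilizer `S`: it is a unit vector fixed by
every element of `S`. -/
def stabilizesState (S : Stabilizer ι) (ψ : (ι → Fin 2) → ℂ) : Prop :=
  (∑ x, Complex.normSq (ψ x)) = 1 ∧ ∀ M ∈ S.elems, (PauliOp.toMatrix M).mulVec ψ = ψ

/-- `ψ` is a stabilizer state. -/
def IsStabilizerState (ψ : (ι → Fin 2) → ℂ) : Prop :=
  ∃ S : Stabilizer ι, stabilizesState S ψ

/-- `A_ω(ψ)`: the number of stabilizer elements with support exactly `ω`. -/
def Aomega (S : Stabilizer ι) (ω : Finset ι) : ℕ :=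
  (S.elems.filter fun M => PauliOp.support M = ω).card

/-- `ω` is a minimal support of `S`: it is the support of some element of `S`, and no
element of `S` has nonempty support strictly contained in `ω`. -/
def IsMinimalSupport (S : Stabilizer ι) (ω : Finset ι) : Prop :=
  (∃ M ∈ S.elems, PauliOp.support M = ω) ∧
    ∀ M ∈ S.elems, PauliOp.support M ⊂ ω → PauliOp.support M = ∅

/-- The matrices of the minimal elements of `S` (the elements whose support is a
minimal support). -/
def minimalMatrices (S : Stabilizer ι) : Set (Matrix (ι → Fin 2) (ι → Fin 2) ℂ) :=
  {A | ∃ M ∈ S.elems, IsMinimalSupport S (PauliOp.support M) ∧ PauliOp.toMatrix M = A}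

/-- `M` belongs to the subgroup `ℳ(ψ)` of `S` generated by the minimal elements.
(Every stabilizer element is an involution, so the generated submonoid coincides with
the generated subgroup.) -/
def inMinimalSubgroup (S : Stabilizer ι) (M : PauliOp ι) : Prop :=
  M ∈ S.elems ∧ PauliOp.toMatrix M ∈ Submonoid.closure (minimalMatrices S)

/-- A one-qubit Clifford operation: a unitary mapping each of the three Pauli matrices
to a Pauli matrix, up to sign, under conjugation. -/
def IsClifford (U : Matrix (Fin 2) (Fin 2) ℂ) : Prop :=
  U ∈ Matrix.unitaryGroup (Fin 2) ℂ ∧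
    ∃ π : Equiv.Perm (Fin 3), ∀ u : Fin 3, ∃ s : ℂ, (s = 1 ∨ s = -1) ∧
      U * pauliMat u.succ * Uᴴ = s • pauliMat (π u).succ

/-- Local unitary equivalence of pure states. -/
def LUequiv (ψ φ : (ι → Fin 2) → ℂ) : Prop :=
  ∃ U : ι → Matrix (Fin 2) (Fin 2) ℂ,
    (∀ i, U i ∈ Matrix.unitaryGroup (Fin 2) ℂ) ∧ (kron U).mulVec ψ = φ

/-- Local Clifford equivalence of pure states. -/
def LCequiv (ψ φ : (ι → Fin 2) → ℂ) : Prop :=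
  ∃ U : ι → Matrix (Fin 2) (Fin 2) ℂ,
    (∀ i, IsClifford (U i)) ∧ (kron U).mulVec ψ = φ

/-- Local Clifford equivalence of (possibly mixed) states. -/
def LCequivMixed (ρ ρ' : Matrix (ι → Fin 2) (ι → Fin 2) ℂ) : Prop :=
  ∃ U : ι → Matrix (Fin 2) (Fin 2) ℂ,
    (∀ i, IsClifford (U i)) ∧ kron U * ρ * (kron U)ᴴ = ρ'

/-- A pure state is fully entangled if it is not a tensor product of states on two
complementary nonempty subsets of the qubits. -/
def FullyEntangled (ψ : (ι → Fin 2) → ℂ) : Prop :=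
  ¬ ∃ (ω : Finset ι) (φ : ({i // i ∈ ω} → Fin 2) → ℂ) (χ : ({i // i ∉ ω} → Fin 2) → ℂ),
      ω ≠ ∅ ∧ ω ≠ Finset.univ ∧
        ∀ x : ι → Fin 2, ψ x = φ (fun i => x i.1) * χ (fun i => x i.1)

/-- Recombine an assignment on `ω` and one on its complement into a global assignment. -/
def mergeAssign (ω : Finset ι) (x : {i // i ∈ ω} → Fin 2) (z : {i // i ∉ ω} → Fin 2) :
    ι → Fin 2 :=
  fun i => if h : i ∈ ω then x ⟨i, h⟩ else z ⟨i, h⟩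

/-- The reduced density matrix `ρ_ω(ψ)` of the pure state `ψ` on the qubits in `ω`
(partial trace of `|ψ⟩⟨ψ|` over the qubits outside `ω`). -/
def reducedState (ψ : (ι → Fin 2) → ℂ) (ω : Finset ι) :
    Matrix ({i // i ∈ ω} → Fin 2) ({i // i ∈ ω} → Fin 2) ℂ :=
  Matrix.of fun x y =>
    ∑ z : {i // i ∉ ω} → Fin 2, ψ (mergeAssign ω x z) * (starRingEnd ℂ) (ψ (mergeAssign ω y z))

/-- The restriction `α_M M_{i₁} ⊗ ⋯ ⊗ M_{i_k}` of a Pauli operator to the qubits in `ω`. -/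
def PauliOp.restrict (M : PauliOp ι) (ω : Finset ι) :
    Matrix ({i // i ∈ ω} → Fin 2) ({i // i ∈ ω} → Fin 2) ℂ :=
  M.phase • kron fun i : {i // i ∈ ω} => pauliMat (M.label i.1)

/-- The `n`-qubit GHZ state `(|0…0⟩ + |1…1⟩)/√2`. -/
def ghz (n : ℕ) : (Fin n → Fin 2) → ℂ :=
  fun x => if x = (fun _ => 0) ∨ x = (fun _ => 1) then ((Real.sqrt 2 : ℝ)⁻¹ : ℂ) else 0

/-- The `2n × 2n` binary symplectic form `P = [[0, I], [I, 0]]`. -/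
def Pmat (n : ℕ) : Matrix (Fin n ⊕ Fin n) (Fin n ⊕ Fin n) (ZMod 2) :=
  Matrix.fromBlocks 0 1 1 0

end

section Pauli

theorem pauliMat_zero : pauliMat 0 = 1 := rfl

theorem conjTranspose_pauliMat (a : Fin 4) : (pauliMat a)ᴴ = pauliMat a := by
  fin_cases a <;> ext i j <;> fin_cases i <;> fin_cases j <;> simp [pauliMat]

theorem pauliMat_mul_self (a : Fin 4) : pauliMat a * pauliMat a = 1 := by
  fin_cases a <;> ext i j <;> fin_cases i <;> fin_cases j <;>
    simp [pauliMat, Matrix.mul_apply]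

theorem trace_pauliMat_mul_of_ne {a b : Fin 4} (h : a ≠ b) :
    (pauliMat a * pauliMat b).trace = 0 := by
  fin_cases a <;> fin_cases b <;> first
    | exact absurd rfl h
    | simp [pauliMat, Matrix.trace]

theorem trace_pauliMat_of_ne_zero {a : Fin 4} (h : a ≠ 0) : (pauliMat a).trace = 0 := by
  simpa [pauliMat_zero] using trace_pauliMat_mul_of_ne h

theorem eq_of_pauliMat_eq_smul {a b : Fin 4} {r : ℂ} (h : pauliMat a = r • pauliMat b) :
    a = b := by
  by_contra hab
  have h0 := trace_pauliMat_mul_of_ne (Ne.symm hab)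
  have h1 := congrArg (pauliMat b * ·) h
  simp only [Matrix.mul_smul, pauliMat_mul_self] at h1
  rw [h1] at h0
  have hr : r = 0 := by simpa [Matrix.trace] using h0
  have h2 := pauliMat_mul_self a
  rw [h, hr] at h2
  simpa using congrFun (congrFun h2 0) 0

theorem I_smul_pauliMat_mul {a m c : Fin 3} (ham : a ≠ m) (hca : c ≠ a) (hcm : c ≠ m) :
    ∃ r : ℂ, (r = 1 ∨ r = -1) ∧
      Complex.I • (pauliMat m.succ * pauliMat a.succ) = r • pauliMat c.succ := by
  by_cases h : (m, a, c) = (0, 2, 1) ∨ (m, a, c) = (2, 1, 0) ∨ (m, a, c) = (1, 0, 2)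
  · refine ⟨1, Or.inl rfl, ?_⟩
    simp only [Prod.mk.injEq] at h
    rcases h with ⟨rfl, rfl, rfl⟩ | ⟨rfl, rfl, rfl⟩ | ⟨rfl, rfl, rfl⟩ <;>
      ext i j <;> fin_cases i <;> fin_cases j <;>
      simp [pauliMat, Fin.succ]
  · refine ⟨-1, Or.inr rfl, ?_⟩
    fin_cases m <;> fin_cases a <;> fin_cases c <;> first
      | exact absurd rfl ham
      | exact absurd rfl hca
      | exact absurd rfl hcm
      | exact absurd (by decide) h
      | (ext i j; fin_cases i <;> fin_cases j <;>
          simp [pauliMat, Fin.succ])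

end Pauli

section Kron

variable {ι : Type}

theorem kron_apply [Fintype ι] (A : ι → Matrix (Fin 2) (Fin 2) ℂ) (x y : ι → Fin 2) :
    kron A x y = ∏ i, A i (x i) (y i) := rfl

theorem kron_mul [Fintype ι] [DecidableEq ι] (A B : ι → Matrix (Fin 2) (Fin 2) ℂ) :
    kron A * kron B = kron fun i => A i * B i := by
  ext x y
  simp only [Matrix.mul_apply, kron_apply, ← Finset.prod_mul_distrib]
  rw [Finset.prod_univ_sum, Fintype.piFinset_univ]

theorem kron_one [Fintype ι] : kron (fun _ : ι => (1 : Matrix (Fin 2) (Fin 2) ℂ)) = 1 := by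
  ext x y
  simp only [kron_apply, Matrix.one_apply]
  split_ifs with h
  · simp [h]
  · obtain ⟨i, hi⟩ := Function.ne_iff.mp h
    exact Finset.prod_eq_zero (Finset.mem_univ i) (by simp [hi])

theorem trace_kron [Fintype ι] [DecidableEq ι] (A : ι → Matrix (Fin 2) (Fin 2) ℂ) :
    (kron A).trace = ∏ i, (A i).trace := by
  simp only [Matrix.trace, Matrix.diag, kron_apply]
  rw [Finset.prod_univ_sum, Fintype.piFinset_univ]

theorem PauliOp.phase_ne_zero (M : PauliOp ι) : M.phase ≠ 0 := by
  rcases M.phase_ok with h | h | h | h <;> simp [h]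

theorem PauliOp.ext_of {M N : PauliOp ι} (hp : M.phase = N.phase) (hl : M.label = N.label) :
    M = N := by
  cases M; cases N; simp_all

theorem PauliOp.toMatrix_mul_self [Fintype ι] [DecidableEq ι] (M : PauliOp ι) :
    M.toMatrix * M.toMatrix = (M.phase * M.phase) • 1 := by
  simp [PauliOp.toMatrix, kron_mul, pauliMat_mul_self, kron_one, smul_smul]

theorem PauliOp.toMatrix_injective [Fintype ι] [DecidableEq ι] :
    Function.Injective (PauliOp.toMatrix : PauliOp ι → _) := by
  intro M N h
  have h1 := congrArg (· * kron fun i => pauliMat (N.label i)) h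
  simp only [PauliOp.toMatrix, Matrix.smul_mul, kron_mul, pauliMat_mul_self, kron_one] at h1
  have hl : M.label = N.label := by
    by_contra hne
    obtain ⟨i, hi⟩ := Function.ne_iff.mp hne
    have h2 := congrArg Matrix.trace h1
    rw [Matrix.trace_smul, trace_kron,
      Finset.prod_eq_zero (Finset.mem_univ i) (trace_pauliMat_mul_of_ne hi)] at h2
    simp [N.phase_ne_zero] at h2
  refine PauliOp.ext_of ?_ hl
  rw [hl] at h1
  simp only [pauliMat_mul_self, kron_one] at h1
  simpa using congrFun (congrFun h1 0) 0

theorem PauliOp.toMatrix_mul_left_cancel [Fintype ι] [DecidableEq ι] (M : PauliOp ι)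
    {A B : Matrix (ι → Fin 2) (ι → Fin 2) ℂ} (h : M.toMatrix * A = M.toMatrix * B) : A = B := by
  have h1 := congrArg (M.toMatrix * ·) h
  simp only [← Matrix.mul_assoc, M.toMatrix_mul_self, Matrix.smul_mul, Matrix.one_mul] at h1
  exact smul_right_injective _ (mul_ne_zero M.phase_ne_zero M.phase_ne_zero) h1

/-- The one-qubit factor of `M` at `i`, pulled back along the local unitary `U`. -/
def pullback (U : ι → Matrix (Fin 2) (Fin 2) ℂ) (M : PauliOp ι) (i : ι) :
    Matrix (Fin 2) (Fin 2) ℂ :=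
  (U i)ᴴ * pauliMat (M.label i) * U i

variable {U : ι → Matrix (Fin 2) (Fin 2) ℂ}

theorem conjTranspose_mul_self_of_unitary {V : Matrix (Fin 2) (Fin 2) ℂ}
    (hV : V ∈ Matrix.unitaryGroup (Fin 2) ℂ) : Vᴴ * V = 1 :=
  Matrix.mem_unitaryGroup_iff'.mp hV

theorem mul_conjTranspose_self_of_unitary {V : Matrix (Fin 2) (Fin 2) ℂ}
    (hV : V ∈ Matrix.unitaryGroup (Fin 2) ℂ) : V * Vᴴ = 1 :=
  Matrix.mem_unitaryGroup_iff.mp hV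

theorem conjTranspose_pullback (M : PauliOp ι) (i : ι) :
    (pullback U M i)ᴴ = pullback U M i := by
  simp [pullback, Matrix.conjTranspose_mul, conjTranspose_pauliMat, Matrix.mul_assoc]

theorem conj_pullback (hU : ∀ i, U i ∈ Matrix.unitaryGroup (Fin 2) ℂ) (M : PauliOp ι) (i : ι) :
    U i * pullback U M i * (U i)ᴴ = pauliMat (M.label i) := by
  have h := mul_conjTranspose_self_of_unitary (hU i)
  calc U i * pullback U M i * (U i)ᴴ
      = (U i * (U i)ᴴ) * pauliMat (M.label i) * (U i * (U i)ᴴ) := by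
        simp only [pullback, Matrix.mul_assoc]
    _ = _ := by simp [h]

theorem mul_pullback (hU : ∀ i, U i ∈ Matrix.unitaryGroup (Fin 2) ℂ) (M : PauliOp ι) (i : ι) :
    U i * pullback U M i = pauliMat (M.label i) * U i := by
  simp only [pullback, ← Matrix.mul_assoc, mul_conjTranspose_self_of_unitary (hU i),
    Matrix.one_mul]

theorem pullback_mul_self (hU : ∀ i, U i ∈ Matrix.unitaryGroup (Fin 2) ℂ) (M : PauliOp ι)
    (i : ι) : pullback U M i * pullback U M i = 1 := by
  conv_lhs => enter [1]; rw [pullback]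
  rw [Matrix.mul_assoc, mul_pullback hU, Matrix.mul_assoc, ← Matrix.mul_assoc (pauliMat _),
    pauliMat_mul_self, Matrix.one_mul, conjTranspose_mul_self_of_unitary (hU i)]

theorem pullback_of_label_eq_zero (hU : ∀ i, U i ∈ Matrix.unitaryGroup (Fin 2) ℂ)
    {M : PauliOp ι} {i : ι} (h : M.label i = 0) : pullback U M i = 1 := by
  simp [pullback, h, pauliMat_zero, conjTranspose_mul_self_of_unitary (hU i)]

theorem trace_pullback (hU : ∀ i, U i ∈ Matrix.unitaryGroup (Fin 2) ℂ)
    {M : PauliOp ι} {i : ι} (h : M.label i ≠ 0) : (pullback U M i).trace = 0 := by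
  rw [pullback, Matrix.mul_assoc, Matrix.trace_mul_comm, Matrix.mul_assoc,
    mul_conjTranspose_self_of_unitary (hU i), Matrix.mul_one, trace_pauliMat_of_ne_zero h]

theorem toMatrix_mul_kron [Fintype ι] [DecidableEq ι]
    (hU : ∀ i, U i ∈ Matrix.unitaryGroup (Fin 2) ℂ) (M : PauliOp ι) :
    M.toMatrix * kron U = M.phase • (kron U * kron (pullback U M)) := by
  simp only [PauliOp.toMatrix, Matrix.smul_mul, kron_mul, mul_pullback hU]

theorem kron_left_inv [Fintype ι] [DecidableEq ι] (hU : ∀ i, U i ∈ Matrix.unitaryGroup (Fin 2) ℂ) :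
    kron (fun i => (U i)ᴴ) * kron U = 1 := by
  simp only [kron_mul, conjTranspose_mul_self_of_unitary (hU _), kron_one]

/-- A traceless or trivial Hermitian involution which conjugates `σ_z` to a diagonal matrix is
diagonal or antidiagonal, according to the sign of the result. -/
theorem diagonal_or_antidiagonal {B : Matrix (Fin 2) (Fin 2) ℂ} (hB : Bᴴ = B) (hBB : B * B = 1)
    (htr : B = 1 ∨ B.trace = 0) (h : (B * pauliMat 3 * B) 1 0 = 0) :
    (B 1 0 = 0 ∧ B 0 1 = 0 ∧ (B * pauliMat 3 * B) 0 0 = 1) ∨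
      (B 0 0 = 0 ∧ B 1 1 = 0 ∧ (B * pauliMat 3 * B) 0 0 = -1) := by
  rcases htr with rfl | htr
  · left; simp [pauliMat]
  have h01 : B 0 1 = star (B 1 0) := by
    conv_lhs => rw [← hB]
    rfl
  have h11 : B 1 1 = -B 0 0 := by
    rw [Matrix.trace_fin_two] at htr; linear_combination htr
  have h00 := congrFun (congrFun hBB 0) 0
  simp [Matrix.mul_apply, Fin.sum_univ_two, pauliMat] at h h00 ⊢
  rw [h11] at h ⊢
  have h' : B 0 0 * B 1 0 = 0 := by linear_combination h / 2
  rcases mul_eq_zero.mp h' with hz | hz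
  · right
    simp [hz] at h00 ⊢
    linear_combination h00
  · left
    have : B 0 1 = 0 := by rw [h01, hz]; simp
    simp [hz, this] at h00 ⊢
    exact h00

end Kron

section GHZ

variable {n : ℕ}

theorem kron_mulVec_ghz (hn : 0 < n) (A : Fin n → Matrix (Fin 2) (Fin 2) ℂ) (x : Fin n → Fin 2) :
    (kron A).mulVec (ghz n) x =
      ((Real.sqrt 2 : ℝ)⁻¹ : ℂ) * (∏ i, A i (x i) 0 + ∏ i, A i (x i) 1) := by
  have hne : (fun _ : Fin n => (0 : Fin 2)) ≠ fun _ => 1 := fun h => by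
    simpa using congrFun h ⟨0, hn⟩
  have hg : ∀ y, ghz n y = (if y = (fun _ => 0) then ((Real.sqrt 2 : ℝ)⁻¹ : ℂ) else 0) +
      if y = (fun _ => 1) then ((Real.sqrt 2 : ℝ)⁻¹ : ℂ) else 0 := by
    intro y
    by_cases h0 : y = fun _ => 0
    · subst h0; simp [ghz, hne]
    · simp [ghz, h0]
  simp only [Matrix.mulVec, dotProduct, hg, mul_add, Finset.sum_add_distrib, mul_ite, mul_zero,
    Finset.sum_ite_eq', Finset.mem_univ, if_true, kron_apply]
  ring

/-- `kron A` fixes the GHZ state up to the inverse of the scalar `c` iff its amplitudes do. -/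
theorem smul_kron_mulVec_ghz_iff (hn : 0 < n) (c : ℂ) (A : Fin n → Matrix (Fin 2) (Fin 2) ℂ) :
    c • (kron A).mulVec (ghz n) = ghz n ↔ ∀ x : Fin n → Fin 2,
      c * (∏ i, A i (x i) 0 + ∏ i, A i (x i) 1) =
        if x = (fun _ => 0) ∨ x = (fun _ => 1) then 1 else 0 := by
  have h2 : ((Real.sqrt 2 : ℝ)⁻¹ : ℂ) ≠ 0 := by simp
  rw [funext_iff]
  refine forall_congr' fun x => ?_
  rw [Pi.smul_apply, kron_mulVec_ghz hn, smul_eq_mul, mul_left_comm, ghz]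
  constructor
  · intro h
    apply mul_left_cancel₀ h2
    rw [h]; split_ifs <;> simp
  · intro h
    rw [h]; split_ifs <;> simp

/-- A two-qubit product operator fixing the GHZ state on at least three qubits. -/
theorem pair_of_kron_mulVec_ghz (hn : 3 ≤ n) {A : Fin n → Matrix (Fin 2) (Fin 2) ℂ}
    {i j : Fin n} (hij : i ≠ j) (hA : ∀ k, k ≠ i → k ≠ j → A k = 1)
    (h : (kron A).mulVec (ghz n) = ghz n) :
    A i 0 0 * A j 0 0 = 1 ∧ A i 1 0 = 0 ∧ A j 1 0 = 0 := by
  have hn0 : 0 < n := by omega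
  obtain ⟨k, hk⟩ : ∃ k, k ∉ ({i, j} : Finset (Fin n)) := by
    by_contra! hc
    have := Finset.card_le_card (s := Finset.univ) (t := {i, j}) fun k _ => hc k
    have h2 := Finset.card_le_two (a := i) (b := j)
    simp at this
    omega
  simp only [Finset.mem_insert, Finset.mem_singleton, not_or] at hk
  have hc := (smul_kron_mulVec_ghz_iff hn0 1 A).mp (by rw [one_smul, h])
  have key : ∀ x : Fin n → Fin 2, (∀ l, l ≠ i → l ≠ j → x l = 0) →
      A i (x i) 0 * A j (x j) 0 = if x = (fun _ => 0) ∨ x = (fun _ => 1) then 1 else 0 := by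
    intro x hx
    rw [← hc x, one_mul, Finset.prod_eq_zero (i := k) (f := fun l => A l (x l) 1)
      (Finset.mem_univ k) (by simp [hA k hk.1 hk.2, hx k hk.1 hk.2]), add_zero]
    symm
    refine Finset.prod_eq_mul i j hij ?_ (fun h => absurd (Finset.mem_univ _) h)
      (fun h => absurd (Finset.mem_univ _) h)
    rintro l - ⟨hli, hlj⟩
    simp [hA l hli hlj, hx l hli hlj]
  have h00 : A i 0 0 * A j 0 0 = 1 := by
    simpa using key (fun _ => 0) (by simp)
  have off : ∀ l, l = i ∨ l = j →
      ¬ (Function.update (fun _ : Fin n => (0 : Fin 2)) l 1 = (fun _ => 0) ∨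
        Function.update (fun _ : Fin n => (0 : Fin 2)) l 1 = (fun _ => 1)) := by
    rintro l hl (h | h)
    · simpa using congrFun h l
    · have hkl : k ≠ l := by rcases hl with rfl | rfl; exacts [hk.1, hk.2]
      simpa [hkl] using congrFun h k
  refine ⟨h00, ?_, ?_⟩
  · have := key (Function.update (fun _ => 0) i 1) (fun l hl _ => by simp [hl])
    rw [if_neg (off i (Or.inl rfl))] at this
    simp only [Function.update_self, Function.update_of_ne hij.symm] at this
    exact (mul_eq_zero.mp this).resolve_right (right_ne_zero_of_mul_eq_one h00)
  · have := key (Function.update (fun _ => 0) j 1) (fun l _ hl => by simp [hl])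
    rw [if_neg (off j (Or.inr rfl))] at this
    simp only [Function.update_self, Function.update_of_ne hij] at this
    exact (mul_eq_zero.mp this).resolve_left (left_ne_zero_of_mul_eq_one h00)

theorem kron_sigmaZ_pair_mulVec_ghz (hn : 0 < n) {i j : Fin n} (hij : i ≠ j) :
    (kron fun k => if k = i ∨ k = j then pauliMat 3 else 1).mulVec (ghz n) = ghz n := by
  rw [← one_smul ℂ ((kron _).mulVec (ghz n)), smul_kron_mulVec_ghz_iff hn]
  intro x
  have hdiag : ∀ k, ∀ a b : Fin 2, a ≠ b →
      (if k = i ∨ k = j then pauliMat 3 else 1 : Matrix (Fin 2) (Fin 2) ℂ) a b = 0 := by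
    intro k a b hab
    split_ifs
    · fin_cases a <;> fin_cases b <;> simp [pauliMat] at hab ⊢
    · simp [hab]
  have hconst : ∀ a : Fin 2, ∏ k : Fin n,
      (if k = i ∨ k = j then pauliMat 3 else 1 : Matrix (Fin 2) (Fin 2) ℂ) a a = 1 := by
    intro a
    rw [Finset.prod_eq_mul i j hij (by
      rintro l - ⟨hli, hlj⟩
      simp [hli, hlj]) (fun h => absurd (Finset.mem_univ _) h)
      (fun h => absurd (Finset.mem_univ _) h)]
    fin_cases a <;> simp [pauliMat]
  have hoff : ∀ a : Fin 2, x ≠ (fun _ => a) → ∏ k : Fin n,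
      (if k = i ∨ k = j then pauliMat 3 else 1 : Matrix (Fin 2) (Fin 2) ℂ) (x k) a = 0 := by
    intro a ha
    obtain ⟨k, hk⟩ := Function.ne_iff.mp ha
    exact Finset.prod_eq_zero (Finset.mem_univ k) (hdiag k _ _ hk)
  have hne : (fun _ : Fin n => (0 : Fin 2)) ≠ fun _ => 1 := fun h => by
    simpa using congrFun h ⟨0, hn⟩
  by_cases h0 : x = fun _ => 0
  · rw [hoff 1 (h0 ▸ hne)]
    subst h0
    simp [hconst]
  by_cases h1 : x = fun _ => 1
  · rw [hoff 0 h0]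
    subst h1
    simp [hconst]
  · simp [hoff 0 h0, hoff 1 h1, h0, h1]

end GHZ

section StabilizerOfGHZ

variable {n : ℕ} {U : Fin n → Matrix (Fin 2) (Fin 2) ℂ}

theorem pullback_mulVec_ghz (hU : ∀ i, U i ∈ Matrix.unitaryGroup (Fin 2) ℂ)
    {φ : (Fin n → Fin 2) → ℂ} (hφ : (kron U).mulVec (ghz n) = φ) {M : PauliOp (Fin n)}
    (hM : M.toMatrix.mulVec φ = φ) :
    M.phase • (kron (pullback U M)).mulVec (ghz n) = ghz n := by
  subst hφ
  have h := congrArg (kron fun i => (U i)ᴴ).mulVec hM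
  rw [Matrix.mulVec_mulVec, Matrix.mulVec_mulVec, Matrix.mulVec_mulVec, Matrix.mul_assoc,
    toMatrix_mul_kron hU, Matrix.mul_smul, ← Matrix.mul_assoc, kron_left_inv hU,
    Matrix.one_mul, Matrix.one_mulVec, Matrix.smul_mulVec] at h
  exact h

/-- Every one-qubit factor of `M`, pulled back along `U`, is diagonal. -/
def PullsBackDiagonal (U : Fin n → Matrix (Fin 2) (Fin 2) ℂ) (M : PauliOp (Fin n)) : Prop :=
  ∀ i, pullback U M i 1 0 = 0 ∧ pullback U M i 0 1 = 0

/-- Every one-qubit factor of `M`, pulled back along `U`, is antidiagonal. -/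
def PullsBackAntidiagonal (U : Fin n → Matrix (Fin 2) (Fin 2) ℂ) (M : PauliOp (Fin n)) : Prop :=
  ∀ i, pullback U M i 0 0 = 0 ∧ pullback U M i 1 1 = 0

theorem pullback_eq_one_or_trace_eq_zero (hU : ∀ i, U i ∈ Matrix.unitaryGroup (Fin 2) ℂ)
    (M : PauliOp (Fin n)) (i : Fin n) : pullback U M i = 1 ∨ (pullback U M i).trace = 0 := by
  by_cases h : M.label i = 0
  · exact Or.inl (pullback_of_label_eq_zero hU h)
  · exact Or.inr (trace_pullback hU h)

theorem pullsBack_diagonal_or_antidiagonal (hn : 3 ≤ n)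
    (hU : ∀ i, U i ∈ Matrix.unitaryGroup (Fin 2) ℂ) {M : PauliOp (Fin n)}
    (hM : M.phase • (kron (pullback U M)).mulVec (ghz n) = ghz n) :
    PullsBackDiagonal U M ∨ PullsBackAntidiagonal U M := by
  have hpair : ∀ i j, i ≠ j →
      (pullback U M i * pauliMat 3 * pullback U M i) 0 0 *
        (pullback U M j * pauliMat 3 * pullback U M j) 0 0 = 1 ∧
      (pullback U M i * pauliMat 3 * pullback U M i) 1 0 = 0 ∧
      (pullback U M j * pauliMat 3 * pullback U M j) 1 0 = 0 := by
    intro i j hij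
    have hfix : (kron fun k => pullback U M k * (if k = i ∨ k = j then pauliMat 3 else 1) *
        pullback U M k).mulVec (ghz n) = ghz n := by
      conv_lhs => rw [← hM]
      rw [Matrix.mulVec_smul, Matrix.mulVec_mulVec, kron_mul]
      simp only [Matrix.mul_assoc, pullback_mul_self hU, Matrix.mul_one]
      rw [← kron_mul, ← Matrix.mulVec_mulVec, kron_sigmaZ_pair_mulVec_ghz (by omega) hij, hM]
    have h := pair_of_kron_mulVec_ghz hn hij (fun k hki hkj => by
      simp [hki, hkj, pullback_mul_self hU]) hfix
    simpa using h
  have hdich := fun i h => diagonal_or_antidiagonal (conjTranspose_pullback M i)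
    (pullback_mul_self hU M i) (pullback_eq_one_or_trace_eq_zero hU M i) h
  have h01 : (⟨0, by omega⟩ : Fin n) ≠ ⟨1, by omega⟩ := by simp
  rcases hdich _ (hpair _ _ h01).2.1 with ⟨h10, h01', hs⟩ | ⟨h00, h11, hs⟩
  · left
    intro i
    by_cases hi : i = ⟨0, by omega⟩
    · subst hi; exact ⟨h10, h01'⟩
    obtain ⟨hprod, -, hi0⟩ := hpair _ _ (Ne.symm hi)
    rcases hdich i hi0 with h | h
    · exact ⟨h.1, h.2.1⟩
    · rw [hs, h.2.2] at hprod
      norm_num at hprod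
  · right
    intro i
    by_cases hi : i = ⟨0, by omega⟩
    · subst hi; exact ⟨h00, h11⟩
    obtain ⟨hprod, -, hi0⟩ := hpair _ _ (Ne.symm hi)
    rcases hdich i hi0 with h | h
    · rw [hs, h.2.2] at hprod
      norm_num at hprod
    · exact ⟨h.1, h.2.1⟩

theorem PullsBackDiagonal.exists_sign (hU : ∀ i, U i ∈ Matrix.unitaryGroup (Fin 2) ℂ)
    {M : PauliOp (Fin n)} (hM : PullsBackDiagonal U M) {i : Fin n} (hi : M.label i ≠ 0) :
    ∃ s : ℂ, (s = 1 ∨ s = -1) ∧ pullback U M i = s • pauliMat 3 := by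
  have htr := trace_pullback hU hi
  rw [Matrix.trace_fin_two] at htr
  have h00 := congrFun (congrFun (pullback_mul_self hU M i) 0) 0
  simp only [Matrix.mul_apply, Fin.sum_univ_two, (hM i).1, (hM i).2, Matrix.one_apply_eq,
    mul_zero, add_zero] at h00
  refine ⟨pullback U M i 0 0, mul_self_eq_one_iff.mp h00, ?_⟩
  have h11 : pullback U M i 1 1 = -pullback U M i 0 0 := by linear_combination htr
  ext a b
  fin_cases a <;> fin_cases b <;> simp [pauliMat, (hM i).1, (hM i).2, h11]

theorem PullsBackDiagonal.label_eq (hU : ∀ i, U i ∈ Matrix.unitaryGroup (Fin 2) ℂ)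
    {M N : PauliOp (Fin n)} (hM : PullsBackDiagonal U M) (hN : PullsBackDiagonal U N)
    {i : Fin n} (hMi : M.label i ≠ 0) (hNi : N.label i ≠ 0) : M.label i = N.label i := by
  obtain ⟨s, -, hs⟩ := hM.exists_sign hU hMi
  obtain ⟨t, ht, hNt⟩ := hN.exists_sign hU hNi
  have htt : t * t = 1 := mul_self_eq_one_iff.mpr ht
  apply eq_of_pauliMat_eq_smul (r := s * t)
  rw [← conj_pullback hU M, ← conj_pullback hU N, hs, hNt]
  simp only [Matrix.mul_smul, Matrix.smul_mul, smul_smul, mul_assoc, htt, mul_one]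

theorem PullsBackDiagonal.phase_mul_prod (hn : 0 < n) {M : PauliOp (Fin n)}
    (hM : PullsBackDiagonal U M)
    (hfix : M.phase • (kron (pullback U M)).mulVec (ghz n) = ghz n) :
    M.phase * ∏ i, pullback U M i 0 0 = 1 ∧ M.phase * ∏ i, pullback U M i 1 1 = 1 := by
  have h := (smul_kron_mulVec_ghz_iff hn _ _).mp hfix
  have h0 := h fun _ => 0
  have h1 := h fun _ => 1
  rw [Finset.prod_eq_zero (i := ⟨0, hn⟩) (f := fun i => pullback U M i 0 1)
    (Finset.mem_univ _) (hM _).2] at h0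
  rw [Finset.prod_eq_zero (i := ⟨0, hn⟩) (f := fun i => pullback U M i 1 0)
    (Finset.mem_univ _) (hM _).1] at h1
  exact ⟨by simpa using h0, by simpa using h1⟩

theorem PullsBackDiagonal.even_card_support (hn : 0 < n)
    (hU : ∀ i, U i ∈ Matrix.unitaryGroup (Fin 2) ℂ) {M : PauliOp (Fin n)}
    (hM : PullsBackDiagonal U M)
    (hfix : M.phase • (kron (pullback U M)).mulVec (ghz n) = ghz n) :
    Even M.support.card := by
  obtain ⟨h0, h1⟩ := hM.phase_mul_prod hn hfix
  have h11 : ∀ i, pullback U M i 1 1 =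
      (if M.label i ≠ 0 then -1 else 1) * pullback U M i 0 0 := by
    intro i
    split_ifs with hi
    · have htr := trace_pullback hU hi
      rw [Matrix.trace_fin_two] at htr
      linear_combination htr
    · simp [pullback_of_label_eq_zero hU (not_not.mp hi)]
  have hsign : ∏ i, (if M.label i ≠ 0 then (-1 : ℂ) else 1) = (-1) ^ M.support.card := by
    rw [Finset.prod_ite]
    simp [PauliOp.support]
  simp only [h11, Finset.prod_mul_distrib, hsign] at h1
  have : (-1 : ℂ) ^ M.support.card = 1 := by
    linear_combination h1 - (-1 : ℂ) ^ M.support.card * h0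
  exact (neg_one_pow_eq_one_iff_even (by norm_num)).mp this

theorem eq_of_erase_eq_of_even_card {α : Type*} [DecidableEq α] {s t : Finset α} {j : α}
    (hs : Even s.card) (ht : Even t.card) (h : s.erase j = t.erase j) : s = t := by
  by_cases hsj : j ∈ s <;> by_cases htj : j ∈ t
  · rw [← Finset.insert_erase hsj, h, Finset.insert_erase htj]
  · rw [Finset.erase_eq_of_notMem htj] at h
    have := Finset.card_erase_add_one hsj
    rw [h] at this
    rw [← this] at hs
    exact absurd ht (by simpa [Nat.even_add_one] using hs)
  · rw [Finset.erase_eq_of_notMem hsj] at h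
    have := Finset.card_erase_add_one htj
    rw [← h] at this
    rw [← this] at ht
    exact absurd hs (by simpa [Nat.even_add_one] using ht)
  · rwa [Finset.erase_eq_of_notMem hsj, Finset.erase_eq_of_notMem htj] at h

/-- A stabilizer element of diagonal type is determined by its support, which has even
cardinality; this bounds the number of such elements supported in `A`. -/
theorem card_le_of_pullsBackDiagonal (hn : 0 < n)
    (hU : ∀ i, U i ∈ Matrix.unitaryGroup (Fin 2) ℂ) {T : Finset (PauliOp (Fin n))}
    (hfix : ∀ M ∈ T, M.phase • (kron (pullback U M)).mulVec (ghz n) = ghz n)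
    (hdiag : ∀ M ∈ T, PullsBackDiagonal U M) {A : Finset (Fin n)}
    (hA : ∀ M ∈ T, M.support ⊆ A) {j : Fin n} (hj : j ∈ A) :
    T.card ≤ 2 ^ (A.card - 1) := by
  rw [← Finset.card_erase_of_mem hj, ← Finset.card_powerset]
  refine Finset.card_le_card_of_injOn (fun M => M.support.erase j) ?_ ?_
  · intro M hM
    exact Finset.mem_coe.mpr (Finset.mem_powerset.mpr (Finset.erase_subset_erase j (hA M hM)))
  · intro M hM N hN h
    have hsupp := eq_of_erase_eq_of_even_card ((hdiag M hM).even_card_support hn hU (hfix M hM))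
      ((hdiag N hN).even_card_support hn hU (hfix N hN)) h
    have hlabel : M.label = N.label := by
      funext k
      have hk : M.label k ≠ 0 ↔ N.label k ≠ 0 := by
        simpa [PauliOp.support] using Finset.ext_iff.mp hsupp k
      by_cases h0 : M.label k = 0
      · rw [h0, not_not.mp fun h => hk.mpr h h0]
      · exact (hdiag M hM).label_eq hU (hdiag N hN) h0 (hk.mp h0)
    refine PauliOp.ext_of ?_ hlabel
    have hMp := ((hdiag M hM).phase_mul_prod hn (hfix M hM)).1
    have hNp := ((hdiag N hN).phase_mul_prod hn (hfix N hN)).1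
    have hB : pullback U M = pullback U N := by funext i; simp [pullback, hlabel]
    rw [hB] at hMp
    exact mul_right_cancel₀ (right_ne_zero_of_mul_eq_one hNp) (hMp.trans hNp.symm)

theorem PullsBackAntidiagonal.offDiag_mul (hU : ∀ i, U i ∈ Matrix.unitaryGroup (Fin 2) ℂ)
    {M : PauliOp (Fin n)} (hM : PullsBackAntidiagonal U M) (i : Fin n) :
    pullback U M i 0 1 * pullback U M i 1 0 = 1 := by
  have h00 := congrFun (congrFun (pullback_mul_self hU M i) 0) 0
  simpa [Matrix.mul_apply, Fin.sum_univ_two, (hM i).1] using h00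

/-- A product of two elements of antidiagonal type is not of antidiagonal type. -/
theorem PullsBackAntidiagonal.not_of_mul (hn : 0 < n)
    (hU : ∀ i, U i ∈ Matrix.unitaryGroup (Fin 2) ℂ) {K M N : PauliOp (Fin n)}
    (hM : PullsBackAntidiagonal U M) (hN : PullsBackAntidiagonal U N)
    (h : K.toMatrix = M.toMatrix * N.toMatrix) : ¬ PullsBackAntidiagonal U K := by
  intro hK
  have h1 : K.phase • kron (pullback U K) =
      (N.phase * M.phase) • kron fun i => pullback U M i * pullback U N i := by
    have h2 := congrArg (kron (fun i => (U i)ᴴ) * ·) (congrArg (· * kron U) h)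
    simp only [Matrix.mul_assoc, toMatrix_mul_kron hU, Matrix.mul_smul] at h2
    simp only [← Matrix.mul_assoc M.toMatrix, toMatrix_mul_kron hU, Matrix.smul_mul,
      Matrix.mul_smul, ← Matrix.mul_assoc, kron_left_inv hU, Matrix.one_mul] at h2
    rw [h2, smul_smul, kron_mul]
  have h3 := congrFun (congrFun h1 fun _ => 1) fun _ => 0
  simp only [Matrix.smul_apply, kron_apply, smul_eq_mul] at h3
  rw [Finset.prod_eq_zero (i := ⟨0, hn⟩)
    (f := fun i => (pullback U M i * pullback U N i) 1 0) (Finset.mem_univ _)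
    (by simp [Matrix.mul_apply, Fin.sum_univ_two, (hM _).2, (hN _).1]), mul_zero] at h3
  exact mul_ne_zero K.phase_ne_zero (Finset.prod_ne_zero_iff.mpr fun i _ =>
    right_ne_zero_of_mul_eq_one (hK.offDiag_mul hU i)) h3

variable {S : Stabilizer (Fin n)}

open Classical in
theorem Stabilizer.card_antidiagonal_le (hn : 3 ≤ n)
    (hU : ∀ i, U i ∈ Matrix.unitaryGroup (Fin 2) ℂ)
    (hfix : ∀ M ∈ S.elems, M.phase • (kron (pullback U M)).mulVec (ghz n) = ghz n) :
    (S.elems.filter fun M => ¬ PullsBackDiagonal U M).card ≤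
      (S.elems.filter fun M => PullsBackDiagonal U M).card := by
  have hanti : ∀ M ∈ S.elems, ¬ PullsBackDiagonal U M → PullsBackAntidiagonal U M :=
    fun M hM h => (pullsBack_diagonal_or_antidiagonal hn hU (hfix M hM)).resolve_left h
  rcases (S.elems.filter fun M => ¬ PullsBackDiagonal U M).eq_empty_or_nonempty with h | ⟨M, hM⟩
  · simp [h]
  rw [Finset.mem_filter] at hM
  choose! K hKS hK using S.mul_mem M hM.1
  refine Finset.card_le_card_of_injOn K ?_ ?_
  · intro N hN
    simp only [Finset.coe_filter, Set.mem_ofPred_eq] at hN ⊢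
    refine ⟨hKS N hN.1, ?_⟩
    by_contra h
    exact (hanti M hM.1 hM.2).not_of_mul (by omega) hU (hanti N hN.1 hN.2) (hK N hN.1)
      (hanti _ (hKS N hN.1) h)
  · intro N hN N' hN' h
    simp only [Finset.coe_filter, Set.mem_ofPred_eq] at hN hN'
    apply PauliOp.toMatrix_injective
    apply M.toMatrix_mul_left_cancel
    rw [← hK N hN.1, ← hK N' hN'.1, h]

theorem Stabilizer.exists_antidiagonal (hn : 3 ≤ n)
    (hU : ∀ i, U i ∈ Matrix.unitaryGroup (Fin 2) ℂ)
    (hfix : ∀ M ∈ S.elems, M.phase • (kron (pullback U M)).mulVec (ghz n) = ghz n) :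
    ∃ M ∈ S.elems, PullsBackAntidiagonal U M := by
  by_contra! hno
  have h := card_le_of_pullsBackDiagonal (j := ⟨0, by omega⟩) (A := Finset.univ) (by omega) hU
    hfix (fun M hM => (pullsBack_diagonal_or_antidiagonal hn hU (hfix M hM)).resolve_right
      (hno M hM)) (fun M _ => Finset.subset_univ _) (Finset.mem_univ _)
  rw [S.card_elems, Finset.card_univ, Fintype.card_fin] at h
  have := (Nat.pow_le_pow_iff_right (by norm_num)).mp h
  omega

theorem Stabilizer.exists_diagonal_label_ne_zero (hn : 3 ≤ n)
    (hU : ∀ i, U i ∈ Matrix.unitaryGroup (Fin 2) ℂ)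
    (hfix : ∀ M ∈ S.elems, M.phase • (kron (pullback U M)).mulVec (ghz n) = ghz n)
    (i : Fin n) : ∃ M ∈ S.elems, PullsBackDiagonal U M ∧ M.label i ≠ 0 := by
  classical
  by_contra! hno
  obtain ⟨j, hj⟩ : ∃ j, j ≠ i := by
    have : Nontrivial (Fin n) := Fin.nontrivial_iff_two_le.mpr (by omega)
    exact exists_ne i
  have h := card_le_of_pullsBackDiagonal (j := j) (A := Finset.univ.erase i)
    (T := S.elems.filter fun M => PullsBackDiagonal U M) (by omega) hU
    (fun M hM => hfix M (Finset.mem_filter.mp hM).1) (fun M hM => (Finset.mem_filter.mp hM).2)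
    (fun M hM => Finset.subset_erase.mpr ⟨Finset.subset_univ _, by
      rw [Finset.mem_filter] at hM
      simp [PauliOp.support, hno M hM.1 hM.2]⟩) (by simp [hj])
  have hle := S.card_antidiagonal_le hn hU hfix
  have hsum := Finset.card_filter_add_card_filter_not (s := S.elems) fun M => PullsBackDiagonal U M
  rw [S.card_elems, Fintype.card_fin] at hsum
  rw [Finset.card_erase_of_mem (Finset.mem_univ _), Finset.card_univ, Fintype.card_fin] at h
  obtain ⟨m, rfl⟩ : ∃ m, n = m + 2 := ⟨n - 2, by omega⟩
  simp only [show m + 2 - 1 - 1 = m by omega, pow_succ] at h hsum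
  have := Nat.two_pow_pos m
  omega

end StabilizerOfGHZ

/-- A unitary conjugating `σ_x` and `σ_z` to distinct signed Pauli matrices is Clifford. -/
theorem isClifford_of_conj {C : Matrix (Fin 2) (Fin 2) ℂ} (hC : C ∈ Matrix.unitaryGroup (Fin 2) ℂ)
    {a m : Fin 3} (ham : a ≠ m) {s t : ℂ} (hs : s = 1 ∨ s = -1) (ht : t = 1 ∨ t = -1)
    (hX : C * pauliMat 1 * Cᴴ = t • pauliMat m.succ)
    (hZ : C * pauliMat 3 * Cᴴ = s • pauliMat a.succ) : IsClifford C := by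
  obtain ⟨π, hπ0, hπ2⟩ : ∃ π : Equiv.Perm (Fin 3), π 0 = m ∧ π 2 = a := by
    have hperm : ∀ a m : Fin 3, a ≠ m → ∃ π : Equiv.Perm (Fin 3), π 0 = m ∧ π 2 = a := by decide
    exact hperm a m ham
  obtain ⟨r, hr, hrI⟩ := I_smul_pauliMat_mul (c := π 1) ham
    (by rw [← hπ2]; simp) (by rw [← hπ0]; simp)
  have hY : pauliMat 2 = Complex.I • (pauliMat 1 * pauliMat 3) := by
    ext i j; fin_cases i <;> fin_cases j <;> simp [pauliMat]
  refine ⟨hC, π, fun u => ?_⟩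
  fin_cases u
  · exact ⟨t, ht, by simpa [hπ0] using hX⟩
  · refine ⟨t * s * r, by rcases hs with rfl | rfl <;> rcases ht with rfl | rfl <;>
      rcases hr with rfl | rfl <;> simp, ?_⟩
    calc C * pauliMat 2 * Cᴴ
        = Complex.I • ((C * pauliMat 1 * Cᴴ) * (C * pauliMat 3 * Cᴴ)) := by
          rw [hY]
          simp only [Matrix.mul_smul, Matrix.smul_mul, Matrix.mul_assoc]
          rw [← Matrix.mul_assoc Cᴴ C, conjTranspose_mul_self_of_unitary hC, Matrix.one_mul]
      _ = (t * s * r) • pauliMat (π 1).succ := by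
          rw [hX, hZ, Matrix.smul_mul, Matrix.mul_smul, mul_smul (t * s), ← hrI, smul_smul,
            smul_smul, smul_smul]
          congr 1; ring
  · exact ⟨s, hs, by simpa [hπ2] using hZ⟩

/-- The diagonal phase gate `diag(1, d)`. -/
def phaseGate (d : ℂ) : Matrix (Fin 2) (Fin 2) ℂ := !![1, 0; 0, d]

theorem phaseGate_mem_unitaryGroup {d : ℂ} (hd : d * star d = 1) :
    phaseGate d ∈ Matrix.unitaryGroup (Fin 2) ℂ := by
  rw [Matrix.mem_unitaryGroup_iff]
  ext i j
  fin_cases i <;> fin_cases j <;>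
    simp_all [phaseGate, Matrix.mul_apply, Fin.sum_univ_two, Matrix.star_apply]

theorem phaseGate_conj_sigmaZ {d : ℂ} (hd : d * star d = 1) :
    phaseGate d * pauliMat 3 * (phaseGate d)ᴴ = pauliMat 3 := by
  ext i j
  fin_cases i <;> fin_cases j <;>
    simp_all [phaseGate, pauliMat, Matrix.mul_apply, Fin.sum_univ_two]

theorem phaseGate_conj_sigmaX (d : ℂ) :
    phaseGate d * pauliMat 1 * (phaseGate d)ᴴ = !![0, star d; d, 0] := by
  ext i j
  fin_cases i <;> fin_cases j <;>
    simp [phaseGate, pauliMat, Matrix.mul_apply, Fin.sum_univ_two]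

theorem kron_phaseGate_mulVec_ghz {n : ℕ} (hn : 0 < n) {d : Fin n → ℂ} (hd : ∏ i, d i = 1) :
    (kron fun i => phaseGate (d i)).mulVec (ghz n) = ghz n := by
  rw [← one_smul ℂ ((kron _).mulVec (ghz n)), smul_kron_mulVec_ghz_iff hn]
  have hne : (fun _ : Fin n => (0 : Fin 2)) ≠ fun _ => 1 := fun h => by
    simpa using congrFun h ⟨0, hn⟩
  have hoff : ∀ x : Fin n → Fin 2, ∀ a : Fin 2, x ≠ (fun _ => a) →
      ∏ k : Fin n, phaseGate (d k) (x k) a = 0 := by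
    intro x a ha
    obtain ⟨k, hk⟩ := Function.ne_iff.mp ha
    refine Finset.prod_eq_zero (Finset.mem_univ k) ?_
    generalize x k = b at hk
    fin_cases a <;> fin_cases b <;> simp [phaseGate] at hk ⊢
  intro x
  by_cases h0 : x = fun _ => 0
  · rw [hoff x 1 (h0 ▸ hne)]
    subst h0
    simp [phaseGate]
  by_cases h1 : x = fun _ => 1
  · rw [hoff x 0 h0]
    subst h1
    simp [phaseGate, hd]
  · simp [hoff x 0 h0, hoff x 1 h1, h0, h1]

theorem PullsBackAntidiagonal.phase_mul_prod {n : ℕ} (hn : 0 < n)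
    {U : Fin n → Matrix (Fin 2) (Fin 2) ℂ} {M : PauliOp (Fin n)}
    (hM : PullsBackAntidiagonal U M)
    (hfix : M.phase • (kron (pullback U M)).mulVec (ghz n) = ghz n) :
    M.phase * ∏ i, pullback U M i 0 1 = 1 ∧ M.phase * ∏ i, pullback U M i 1 0 = 1 := by
  have h := (smul_kron_mulVec_ghz_iff hn _ _).mp hfix
  have h0 := h fun _ => 0
  have h1 := h fun _ => 1
  rw [Finset.prod_eq_zero (i := ⟨0, hn⟩) (f := fun i => pullback U M i 0 0)
    (Finset.mem_univ _) (hM _).1] at h0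
  rw [Finset.prod_eq_zero (i := ⟨0, hn⟩) (f := fun i => pullback U M i 1 1)
    (Finset.mem_univ _) (hM _).2] at h1
  exact ⟨by simpa using h0, by simpa using h1⟩

theorem LUequiv.lcEquiv_of_isStabilizerState {n : ℕ} (hn : 3 ≤ n) {φ : (Fin n → Fin 2) → ℂ}
    (hφ : IsStabilizerState φ) (h : LUequiv (ghz n) φ) : LCequiv (ghz n) φ := by
  have hn0 : 0 < n := by omega
  obtain ⟨S, -, hS⟩ := hφ
  obtain ⟨U, hU, hUφ⟩ := h
  have hfix := fun M hM => pullback_mulVec_ghz hU hUφ (hS M hM)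
  choose N hNS hN hNi using S.exists_diagonal_label_ne_zero hn hU hfix
  obtain ⟨M, hMS, hM⟩ := S.exists_antidiagonal hn hU hfix
  have hoff := hM.offDiag_mul hU
  obtain ⟨hp01, hp10⟩ := hM.phase_mul_prod hn0 (hfix M hMS)
  have hphase : M.phase = 1 ∨ M.phase = -1 := by
    rw [← mul_self_eq_one_iff]
    have hprod : (∏ i, pullback U M i 0 1) * ∏ i, pullback U M i 1 0 = 1 := by
      rw [← Finset.prod_mul_distrib]; simp [hoff]
    calc M.phase * M.phase
        = (M.phase * ∏ i, pullback U M i 0 1) * (M.phase * ∏ i, pullback U M i 1 0) := by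
          rw [mul_mul_mul_comm, hprod, mul_one]
      _ = 1 := by rw [hp01, hp10, mul_one]
  let t : Fin n → ℂ := Function.update (fun _ => 1) ⟨0, hn0⟩ M.phase
  have ht : ∀ i, t i = 1 ∨ t i = -1 := by
    intro i
    by_cases hi : i = ⟨0, hn0⟩
    · subst hi; simpa [t] using hphase
    · simp [t, hi]
  have htprod : ∏ i, t i = M.phase := by
    simp [t, Finset.prod_update_of_mem]
  let d : Fin n → ℂ := fun i => t i * pullback U M i 1 0
  have hstar : ∀ i, star (d i) = t i * pullback U M i 0 1 := by
    intro i
    have h01 : star (pullback U M i 1 0) = pullback U M i 0 1 := by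
      conv_rhs => rw [← conjTranspose_pullback]
      rfl
    rw [star_mul', h01]
    rcases ht i with h | h <;> simp [h]
  have hd : ∀ i, d i * star (d i) = 1 := by
    intro i
    rw [hstar]
    linear_combination (t i * t i) * hoff i + mul_self_eq_one_iff.mpr (ht i)
  refine ⟨fun i => U i * phaseGate (d i), fun i => ?_, ?_⟩
  · have hMi : M.label i ≠ 0 := fun h0 => by
      have := (hM i).1
      rw [pullback_of_label_eq_zero hU h0] at this
      simp at this
    obtain ⟨s, hs, hNs⟩ := (hN i).exists_sign hU (hNi i)
    have hne : (N i).label i ≠ M.label i := fun h0 => by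
      have h1 : pullback U (N i) i = pullback U M i := by simp [pullback, h0]
      have h2 := hoff i
      rw [← h1, (hN i i).1] at h2
      simp at h2
    obtain ⟨a, ha⟩ := Fin.exists_succ_eq.mpr (hNi i)
    obtain ⟨m, hm⟩ := Fin.exists_succ_eq.mpr hMi
    have hass : ∀ P, U i * phaseGate (d i) * P * (U i * phaseGate (d i))ᴴ =
        U i * (phaseGate (d i) * P * (phaseGate (d i))ᴴ) * (U i)ᴴ := by
      intro P
      simp only [Matrix.conjTranspose_mul, Matrix.mul_assoc]
    refine isClifford_of_conj (a := a) (m := m) (s := s) (t := t i)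
      (mul_mem (hU i) (phaseGate_mem_unitaryGroup (hd i)))
      (fun h => hne (by rw [← ha, ← hm, h])) hs (ht i) ?_ ?_
    · have hX : !![0, star (d i); d i, 0] = t i • pullback U M i := by
        ext x y
        fin_cases x <;> fin_cases y <;> simp [hM i, d]
        simpa [d] using hstar i
      rw [hass, phaseGate_conj_sigmaX, hX, hm, ← conj_pullback hU M i, Matrix.mul_smul,
        Matrix.smul_mul]
    · have hZ : pauliMat 3 = s • pullback U (N i) i := by
        rw [hNs, smul_smul, mul_self_eq_one_iff.mpr hs, one_smul]
      rw [hass, phaseGate_conj_sigmaZ (hd i), hZ, ha, ← conj_pullback hU (N i) i,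
        Matrix.mul_smul, Matrix.smul_mul]
  · have hdprod : ∏ i, d i = 1 := by
      rw [Finset.prod_mul_distrib, htprod, hp10]
    rw [← kron_mul, ← Matrix.mulVec_mulVec, kron_phaseGate_mulVec_ghz hn0 hdprod, hUφ]

/-- For the `n`-qubit GHZ state (`n ≥ 3`), `LU(GHZₙ) = LC(GHZₙ)`. -/
theorem stmt_10 {n : ℕ} (hn : 3 ≤ n) :
    ∀ φ : (Fin n → Fin 2) → ℂ, IsStabilizerState φ →
      (LUequiv (ghz n) φ ↔ LCequiv (ghz n) φ) := by
  exact fun φ hφ => ⟨fun h => h.lcEquiv_of_isStabilizerState hn hφ,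
    fun ⟨U, hU, h⟩ => ⟨U, fun i => (hU i).1, h⟩⟩
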